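/- arXiv:math/0601248 — 5 statements merged into one kernel-verified Lean document; each statement's English description precedes it below -/
import Mathlib

section
/- Fix an integer ν≥1. Let (v_k)_{k≥1} and (a_k)_{k≥1} be two nondecreasing sequences of nonnegative real numbers such that v₁+a₁ ≥ c₀ and v_k^{(ν−1)/ν} ≤ C₀·(v_{k+1}+a_{k+1}−v_k−a_k−c₁·a_k) for every k≥1, where c₀, c₁, C₀ are positive constants. Then there exists κ>0, depending only on c₀, c₁, C₀ (and ν), such that v_k+a_k ≥ κ·k^ν for every k≥1. -/
theorem add_one_pow_succ_le (n : ℕ) {x : ℝ} (hx : 0 ≤ x) :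
    (x + 1) ^ (n + 1) ≤ x ^ (n + 1) + (n + 1) * (x + 1) ^ n := by
  induction n with
  | zero => simp
  | succ n ih =>
    have h1 : x ^ (n + 1) ≤ (x + 1) ^ (n + 1) := by gcongr; linarith
    have h2 := mul_le_mul_of_nonneg_right ih (by linarith : 0 ≤ x + 1)
    push_cast
    calc (x + 1) ^ (n + 1 + 1) = (x + 1) ^ (n + 1) * (x + 1) := pow_succ _ _
      _ ≤ (x ^ (n + 1) + (n + 1) * (x + 1) ^ n) * (x + 1) := h2
      _ = x ^ (n + 1 + 1) + x ^ (n + 1) + (n + 1) * (x + 1) ^ (n + 1) := by ring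
      _ ≤ _ := by linarith

/-- A discrete comparison principle for the differential inequality `s' ≥ δ s ^ (n / (n + 1))`. -/
theorem mul_pow_le_of_increment_ge (n : ℕ) {δ t : ℝ} (ht : 0 ≤ t)
    (htδ : t * ((n + 1) * 2 ^ n) ≤ δ) (s : ℕ → ℝ) (h_one : t ^ (n + 1) ≤ s 1)
    (hs : ∀ k, 1 ≤ k → s k + δ * s k ^ ((n : ℝ) / (n + 1)) ≤ s (k + 1)) :
    ∀ k : ℕ, 1 ≤ k → (t * k) ^ (n + 1) ≤ s k := by
  have hδ : 0 ≤ δ := le_trans (by positivity) htδ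
  intro k hk
  induction k, hk using Nat.le_induction with
  | base => simpa using h_one
  | succ k hk ih =>
    have hk' : (1 : ℝ) ≤ k := by exact_mod_cast hk
    have h_root : (t * k) ^ n ≤ s k ^ ((n : ℝ) / (n + 1)) := by
      calc (t * k) ^ n = ((t * k) ^ (n + 1)) ^ ((n : ℝ) / (n + 1)) := by
            rw [← Real.rpow_natCast _ (n + 1), ← Real.rpow_mul (by positivity),
              ← Real.rpow_natCast _ n]
            congr 1
            push_cast
            field_simp
        _ ≤ _ := Real.rpow_le_rpow (by positivity) ih (by positivity)
    have h_pow : ((k : ℝ) + 1) ^ n ≤ 2 ^ n * k ^ n := by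
      rw [← mul_pow]
      gcongr
      linarith
    have h_incr : t ^ (n + 1) * ((n + 1) * ((k : ℝ) + 1) ^ n) ≤ δ * (t * k) ^ n := by
      calc t ^ (n + 1) * ((n + 1) * ((k : ℝ) + 1) ^ n)
          ≤ t ^ (n + 1) * ((n + 1) * (2 ^ n * k ^ n)) := by gcongr
        _ = t * ((n + 1) * 2 ^ n) * (t * k) ^ n := by ring
        _ ≤ _ := by gcongr
    calc (t * ((k + 1 : ℕ) : ℝ)) ^ (n + 1) = t ^ (n + 1) * ((k : ℝ) + 1) ^ (n + 1) := by
          rw [mul_pow]; push_cast; rfl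
      _ ≤ t ^ (n + 1) * ((k : ℝ) ^ (n + 1) + (n + 1) * ((k : ℝ) + 1) ^ n) := by
          gcongr
          exact add_one_pow_succ_le n (by positivity)
      _ = (t * k) ^ (n + 1) + t ^ (n + 1) * ((n + 1) * ((k : ℝ) + 1) ^ n) := by ring
      _ ≤ s k + δ * s k ^ ((n : ℝ) / (n + 1)) := by
          have := mul_le_mul_of_nonneg_left h_root hδ
          linarith
      _ ≤ s (k + 1) := hs k hk

/-- **Recursive estimate (Lemma 2.1).** Fix an integer `ν ≥ 1` and positive constants
`c₀, c₁, C₀`. There exists `κ > 0`, depending only on `ν, c₀, c₁, C₀`, such that for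
all nondecreasing sequences `v, a ≥ 0` (indexed by positive integers) with
`v₁ + a₁ ≥ c₀` and `v_k^{(ν-1)/ν} ≤ C₀ (v_{k+1} + a_{k+1} - v_k - a_k - c₁ a_k)` for
every `k ≥ 1`, one has `v_k + a_k ≥ κ k^ν` for every `k ≥ 1`. -/
theorem recursive_lemma_one (ν : ℕ) (hν : 1 ≤ ν) (c₀ c₁ C₀ : ℝ)
    (hc₀ : 0 < c₀) (hc₁ : 0 < c₁) (hC₀ : 0 < C₀) :
    ∃ κ > (0:ℝ), ∀ v a : ℕ → ℝ,
      (∀ k, 1 ≤ k → 0 ≤ v k) → (∀ k, 1 ≤ k → 0 ≤ a k) →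
      (∀ k l, 1 ≤ k → k ≤ l → v k ≤ v l) →
      (∀ k l, 1 ≤ k → k ≤ l → a k ≤ a l) →
      c₀ ≤ v 1 + a 1 →
      (∀ k, 1 ≤ k →
        v k ^ (((ν : ℝ) - 1) / (ν : ℝ)) ≤
          C₀ * (v (k + 1) + a (k + 1) - v k - a k - c₁ * a k)) →
      ∀ k : ℕ, 1 ≤ k → κ * (k : ℝ) ^ ν ≤ v k + a k := by
  obtain ⟨n, rfl⟩ : ∃ n, ν = n + 1 := ⟨ν - 1, by omega⟩
  have h_exp : (((n + 1 : ℕ) : ℝ) - 1) / ((n + 1 : ℕ) : ℝ) = (n : ℝ) / (n + 1) := by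
    push_cast
    ring
  rw [h_exp]
  set α : ℝ := (n : ℝ) / (n + 1) with hα
  have hα0 : 0 ≤ α := by positivity
  have hα1 : 0 ≤ 1 - α := by
    rw [hα, sub_nonneg, div_le_one (by positivity)]
    linarith
  set δ : ℝ := min ((1 / 2) ^ α / C₀) (c₁ / 2 * c₀ ^ (1 - α)) with hδ
  have hδ0 : 0 < δ := by positivity
  set t : ℝ := min (δ / ((n + 1) * 2 ^ n)) (c₀ ^ (((n + 1 : ℕ) : ℝ)⁻¹)) with ht
  have ht0 : 0 < t := by positivity
  refine ⟨t ^ (n + 1), by positivity, ?_⟩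
  intro v a hv ha hvm ham h1 hrec k hk
  rw [← mul_pow]
  refine mul_pow_le_of_increment_ge n (δ := δ) ht0.le ?_ (fun k => v k + a k) ?_ ?_ k hk
  · rw [← le_div_iff₀ (by positivity)]
    exact min_le_left _ _
  · calc t ^ (n + 1) ≤ (c₀ ^ (((n + 1 : ℕ) : ℝ)⁻¹)) ^ (n + 1) := by
          gcongr
          exact min_le_right _ _
      _ = c₀ := Real.rpow_inv_natCast_pow hc₀.le (by omega)
      _ ≤ _ := h1
  · intro k hk
    have hvk := hv k hk
    have hak := ha k hk
    have hsk : c₀ ≤ v k + a k := by linarith [hvm 1 k le_rfl hk, ham 1 k le_rfl hk]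
    have hs0 : 0 < v k + a k := hc₀.trans_le hsk
    have h_step : v k ^ α / C₀ + c₁ * a k ≤ v (k + 1) + a (k + 1) - v k - a k := by
      have := (div_le_iff₀' hC₀).2 (hrec k hk)
      linarith
    suffices h : δ * (v k + a k) ^ α ≤ v k ^ α / C₀ + c₁ * a k by
      change v k + a k + δ * (v k + a k) ^ α ≤ v (k + 1) + a (k + 1)
      linarith
    rcases le_total (a k) (v k) with hle | hle
    · calc δ * (v k + a k) ^ α ≤ (1 / 2) ^ α / C₀ * (v k + a k) ^ α := by
            gcongr
            exact min_le_left _ _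
        _ = (1 / 2 * (v k + a k)) ^ α / C₀ := by
            rw [Real.mul_rpow (by norm_num) hs0.le]
            ring
        _ ≤ v k ^ α / C₀ := by
            gcongr
            linarith
        _ ≤ _ := le_add_of_nonneg_right (by positivity)
    · calc δ * (v k + a k) ^ α ≤ c₁ / 2 * c₀ ^ (1 - α) * (v k + a k) ^ α := by
            gcongr
            exact min_le_right _ _
        _ ≤ c₁ / 2 * (v k + a k) ^ (1 - α) * (v k + a k) ^ α := by gcongr
        _ = c₁ / 2 * (v k + a k) := by
            rw [mul_assoc, ← Real.rpow_add hs0, sub_add_cancel, Real.rpow_one]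
        _ ≤ c₁ * a k := by nlinarith
        _ ≤ _ := le_add_of_nonneg_left (by positivity)
end

section
/- Fix an integer ν≥1. Let (a_k)_{k≥1} be a sequence of nonnegative real numbers such that a₁ ≥ c₀, a_k ≤ C₀·L^ν·k^{ν−1} for every k≥1, and (Σ_{j=1}^{k} a_j)^{(ν−1)/ν} ≤ C₀·(a_{k+1} + Σ_{j=1}^{k} e^{−L(k+1−j)}·a_j) for every k≥1, where L, c₀, C₀ are positive constants. Then, if L is sufficiently large in dependence of c₀ and C₀ (and ν), there exists κ>0, depending only on c₀ and C₀ (and ν), such that a_k ≥ κ·k^{ν−1} for every k≥1. -/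
/-- The elementary comparison of a power sum with the corresponding integral. -/
theorem pow_succ_le_succ_mul_sum_pow (n k : ℕ) :
    (k : ℝ) ^ (n + 1) ≤ (n + 1) * ∑ j ∈ Finset.Icc 1 k, (j : ℝ) ^ n := by
  induction k with
  | zero => simp
  | succ k ih =>
    rw [Finset.sum_Icc_succ_top (by omega)]
    have h := (le_abs_self _).trans (abs_pow_sub_pow_le ((k : ℝ) + 1) (k : ℝ) (n + 1))
    have h1 : max |(k : ℝ) + 1| |(k : ℝ)| = k + 1 := by
      rw [abs_of_nonneg (by positivity), abs_of_nonneg (by positivity)]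
      exact max_eq_left (by linarith)
    rw [h1, add_sub_cancel_left, abs_one, Nat.add_sub_cancel] at h
    push_cast at h ⊢
    linarith

theorem sum_exp_neg_mul_le {L : ℝ} (hL : 1 ≤ L) (k : ℕ) :
    ∑ j ∈ Finset.Icc 1 k, Real.exp (-L * ((k : ℝ) + 1 - (j : ℝ))) ≤ 2 * Real.exp (-L) := by
  have hhalf : Real.exp (-L) ≤ 1 / 2 := by
    rw [Real.exp_neg, ← one_div]
    exact one_div_le_one_div_of_le (by norm_num) (by linarith [Real.add_one_le_exp L])
  induction k with
  | zero => simpa using (Real.exp_pos _).le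
  | succ k ih =>
    have hshift : ∀ j : ℕ, Real.exp (-L * (((k + 1 : ℕ) : ℝ) + 1 - (j : ℝ)))
        = Real.exp (-L) * Real.exp (-L * ((k : ℝ) + 1 - (j : ℝ))) := fun j => by
      rw [← Real.exp_add]
      push_cast
      ring_nf
    rw [Finset.sum_congr rfl fun j _ => hshift j, ← Finset.mul_sum,
      Finset.sum_Icc_succ_top (by omega)]
    push_cast
    rw [sub_self, mul_zero, Real.exp_zero]
    nlinarith [Real.exp_pos (-L)]


/-- **Recursive estimate (Lemma 2.2).** Fix an integer `ν ≥ 1` and positive constants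
`c₀, C₀`. There exist `L₀ > 0` and `κ > 0`, with `κ` depending only on `ν, c₀, C₀`,
such that for all `L ≥ L₀` and all sequences `a ≥ 0` (indexed by positive integers)
with `a₁ ≥ c₀`, `a_k ≤ C₀ L^ν k^{ν-1}` for every `k ≥ 1`, and
`(Σ_{j=1}^k a_j)^{(ν-1)/ν} ≤ C₀ (a_{k+1} + Σ_{j=1}^k e^{-L(k+1-j)} a_j)` for every
`k ≥ 1`, one has `a_k ≥ κ k^{ν-1}` for every `k ≥ 1`. -/
theorem recursive_lemma_two (ν : ℕ) (hν : 1 ≤ ν) (c₀ C₀ : ℝ)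
    (hc₀ : 0 < c₀) (hC₀ : 0 < C₀) :
    ∃ L₀ > (0:ℝ), ∃ κ > (0:ℝ), ∀ L : ℝ, L₀ ≤ L → ∀ a : ℕ → ℝ,
      (∀ k, 1 ≤ k → 0 ≤ a k) →
      c₀ ≤ a 1 →
      (∀ k : ℕ, 1 ≤ k → a k ≤ C₀ * L ^ ν * (k : ℝ) ^ (ν - 1)) →
      (∀ k : ℕ, 1 ≤ k →
        (∑ j ∈ Finset.Icc 1 k, a j) ^ (((ν : ℝ) - 1) / (ν : ℝ)) ≤
          C₀ * (a (k + 1) +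
            ∑ j ∈ Finset.Icc 1 k, Real.exp (-L * ((k : ℝ) + 1 - (j : ℝ))) * a j)) →
      ∀ k : ℕ, 1 ≤ k → κ * (k : ℝ) ^ (ν - 1) ≤ a k := by
  obtain ⟨n, rfl⟩ : ∃ n, ν = n + 1 := ⟨ν - 1, by omega⟩
  simp only [Nat.add_sub_cancel]
  obtain ⟨y, hy, hy1, hyc, hyA⟩ : ∃ y : ℝ, 0 < y ∧ y ≤ 1 ∧ (n + 1) * y ≤ c₀ ∧
      C₀ * (2 * 2 ^ n * ((n + 1) * y)) ≤ 1 := by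
    refine ⟨min 1 (min (c₀ / (n + 1)) (1 / (C₀ * (2 * 2 ^ n * (n + 1))))), by positivity,
      min_le_left _ _, ?_, ?_⟩
    · rw [← le_div_iff₀' (by positivity)]
      exact (min_le_right _ _).trans (min_le_left _ _)
    · calc _ = C₀ * (2 * 2 ^ n * (n + 1)) *
            min 1 (min (c₀ / (n + 1)) (1 / (C₀ * (2 * 2 ^ n * (n + 1))))) := by ring
        _ ≤ 1 := by
          rw [← le_div_iff₀' (by positivity)]
          exact (min_le_right _ _).trans (min_le_right _ _)
  obtain ⟨κ, hκ⟩ : ∃ κ : ℝ, κ = (n + 1) * y ^ (n + 1) := ⟨_, rfl⟩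
  have hκ0 : 0 < κ := by rw [hκ]; positivity
  have hκc : κ ≤ c₀ := by
    rw [hκ]
    refine le_trans ?_ hyc
    gcongr
    exact pow_le_of_le_one hy.le hy1 (by omega)
  have hκy : C₀ * (2 * 2 ^ n * κ) ≤ y ^ n := by
    calc C₀ * (2 * 2 ^ n * κ) = C₀ * (2 * 2 ^ n * ((n + 1) * y)) * y ^ n := by rw [hκ]; ring
      _ ≤ 1 * y ^ n := by gcongr
      _ = y ^ n := one_mul _
  have hlim := (Real.tendsto_pow_mul_exp_neg_atTop_nhds_zero (n + 1)).const_mul (2 * C₀)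
  rw [mul_zero] at hlim
  obtain ⟨M, hM⟩ := Filter.eventually_atTop.1
    (hlim.eventually_le_const (show 0 < 2 ^ n * κ by positivity))
  refine ⟨max 1 M, by positivity, κ, hκ0, fun L hL a ha ha1 hup hrec k hk => ?_⟩
  have hL1 : 1 ≤ L := (le_max_left _ _).trans hL
  have hLM := hM L ((le_max_right _ _).trans hL)
  induction k using Nat.strong_induction_on with
  | _ k ih =>
  obtain rfl | ⟨k, hk1, rfl⟩ : k = 1 ∨ ∃ m, 1 ≤ m ∧ k = m + 1 := by
    rcases eq_or_lt_of_le hk with h | h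
    · exact .inl h.symm
    · exact .inr ⟨k - 1, by omega, by omega⟩
  · simpa using hκc.trans ha1
  have hkR : (1 : ℝ) ≤ k := by exact_mod_cast hk1
  have hS : (y * k) ^ (n + 1) ≤ ∑ j ∈ Finset.Icc 1 k, a j := by
    calc (y * k) ^ (n + 1) = y ^ (n + 1) * (k : ℝ) ^ (n + 1) := mul_pow _ _ _
      _ ≤ y ^ (n + 1) * ((n + 1) * ∑ j ∈ Finset.Icc 1 k, (j : ℝ) ^ n) := by
        gcongr
        exact pow_succ_le_succ_mul_sum_pow n k
      _ = ∑ j ∈ Finset.Icc 1 k, κ * (j : ℝ) ^ n := by rw [← Finset.mul_sum, hκ]; ring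
      _ ≤ _ := Finset.sum_le_sum fun j hj => by
        rw [Finset.mem_Icc] at hj
        exact ih j (by omega) hj.1
  have hlow : (y * k) ^ n ≤
      (∑ j ∈ Finset.Icc 1 k, a j) ^ ((((n + 1 : ℕ) : ℝ) - 1) / ((n + 1 : ℕ) : ℝ)) := by
    calc (y * k) ^ n
        = ((y * k) ^ (n + 1)) ^ ((((n + 1 : ℕ) : ℝ) - 1) / ((n + 1 : ℕ) : ℝ)) := by
          rw [← Real.rpow_natCast _ (n + 1), ← Real.rpow_mul (by positivity),
            mul_div_cancel₀ _ (by positivity)]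
          push_cast
          rw [add_sub_cancel_right, Real.rpow_natCast]
      _ ≤ _ := Real.rpow_le_rpow (by positivity) hS
          (div_nonneg (by push_cast; simp) (by positivity))
  have herr : ∑ j ∈ Finset.Icc 1 k, Real.exp (-L * ((k : ℝ) + 1 - (j : ℝ))) * a j ≤
      2 ^ n * κ * (k : ℝ) ^ n := by
    calc ∑ j ∈ Finset.Icc 1 k, Real.exp (-L * ((k : ℝ) + 1 - (j : ℝ))) * a j
        ≤ ∑ j ∈ Finset.Icc 1 k, Real.exp (-L * ((k : ℝ) + 1 - (j : ℝ))) *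
            (C₀ * L ^ (n + 1) * (k : ℝ) ^ n) := Finset.sum_le_sum fun j hj => by
          rw [Finset.mem_Icc] at hj
          gcongr
          refine (hup j hj.1).trans ?_
          gcongr
          exact hj.2
      _ ≤ 2 * Real.exp (-L) * (C₀ * L ^ (n + 1) * (k : ℝ) ^ n) := by
          rw [← Finset.sum_mul]
          gcongr
          exact sum_exp_neg_mul_le hL1 k
      _ = 2 * C₀ * (L ^ (n + 1) * Real.exp (-L)) * (k : ℝ) ^ n := by ring
      _ ≤ _ := by gcongr
  have hmain : 2 * 2 ^ n * κ * (k : ℝ) ^ n ≤ a (k + 1) + 2 ^ n * κ * (k : ℝ) ^ n := by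
    refine le_of_mul_le_mul_left ?_ hC₀
    calc C₀ * (2 * 2 ^ n * κ * (k : ℝ) ^ n) = C₀ * (2 * 2 ^ n * κ) * (k : ℝ) ^ n := by ring
      _ ≤ y ^ n * (k : ℝ) ^ n := by gcongr
      _ = (y * k) ^ n := (mul_pow _ _ _).symm
      _ ≤ _ := hlow.trans ((hrec k hk1).trans (by gcongr))
  calc κ * ((k + 1 : ℕ) : ℝ) ^ n ≤ κ * (2 * (k : ℝ)) ^ n := by
        gcongr
        push_cast
        linarith
    _ = 2 ^ n * κ * (k : ℝ) ^ n := by rw [mul_pow]; ring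
    _ ≤ a (k + 1) := by linarith
end

section
/- Fix δ∈(0,1/2), M≥1 and ω∈ℝ^{2n}∖{0}, and let 𝒴_M be the class of functions u:ℍⁿ→ℝ that are ω-periodic, satisfy u(ξ)≥1−δ whenever ξ·(ω,0)≥M|ω|, and u(ξ)≤−1+δ whenever ξ·(ω,0)≤−M|ω|. Let u∈𝒴_M be 2-periodic in the vertical direction (u(z,t)=u(z,t+2)). Then: (i) for every k∈ℤ^{2n} with ω·k≥0, min{u, T_k u}∈𝒴_M; (ii) for every k∈ℤ^{2n} with ω·k≤0, max{u, T_k u}∈𝒴_M. Here T_k u(ξ):=u((k,0)∘ξ). -/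
open MeasureTheory Filter

/-- Points of the Heisenberg group `ℍⁿ ≅ ℝ^{2n+1}`, written as `ξ = (x, y, t)`. -/
abbrev Heis (n : ℕ) : Type := (Fin n → ℝ) × (Fin n → ℝ) × ℝ

namespace Heis

variable {n : ℕ}

/-- The Heisenberg group law `ξ ∘ ξ₀ = (z + z₀, t + t₀ + 2 Im (z̄ z₀))`. -/
def mul (ξ ξ₀ : Heis n) : Heis n :=
  (ξ.1 + ξ₀.1, ξ.2.1 + ξ₀.2.1,
    ξ.2.2 + ξ₀.2.2 + 2 * ∑ k, (ξ.1 k * ξ₀.2.1 k - ξ.2.1 k * ξ₀.1 k))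

/-- The group inverse `ξ⁻¹ = (-z, -t)`. -/
def inv (ξ : Heis n) : Heis n := (-ξ.1, -ξ.2.1, -ξ.2.2)

/-- The Koranyi gauge `|ξ|_{ℍⁿ} = (|z|⁴ + t²)^{1/4}`. -/
noncomputable def gauge (ξ : Heis n) : ℝ :=
  ((∑ k, ξ.1 k ^ 2 + ∑ k, ξ.2.1 k ^ 2) ^ 2 + ξ.2.2 ^ 2) ^ (4⁻¹ : ℝ)

/-- The Koranyi ball `𝔅_r(ξ₀) = {ξ : |ξ⁻¹ ∘ ξ₀|_{ℍⁿ} ≤ r}`. -/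
noncomputable def ball (r : ℝ) (ξ₀ : Heis n) : Set (Heis n) :=
  {ξ | gauge (mul (inv ξ) ξ₀) ≤ r}

/-- `X_k u = ∂_{x_k} u + 2 y_k ∂_t u`. -/
noncomputable def Xderiv (u : Heis n → ℝ) (k : Fin n) (ξ : Heis n) : ℝ :=
  fderiv ℝ u ξ (Pi.single k 1, 0, 0) + 2 * ξ.2.1 k * fderiv ℝ u ξ (0, 0, 1)

/-- `Y_k u = ∂_{y_k} u - 2 x_k ∂_t u`. -/
noncomputable def Yderiv (u : Heis n → ℝ) (k : Fin n) (ξ : Heis n) : ℝ :=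
  fderiv ℝ u ξ (0, Pi.single k 1, 0) - 2 * ξ.1 k * fderiv ℝ u ξ (0, 0, 1)

/-- `|∇_{ℍⁿ} u|²`. -/
noncomputable def gradSq (u : Heis n → ℝ) (ξ : Heis n) : ℝ :=
  ∑ k, (Xderiv u k ξ) ^ 2 + ∑ k, (Yderiv u k ξ) ^ 2

/-- The Ginzburg–Landau energy `ℱ_S(u) = ∫_S |∇_{ℍⁿ} u|² + F(ξ, u(ξ)) dξ`. -/
noncomputable def energy (F : Heis n → ℝ → ℝ) (S : Set (Heis n)) (u : Heis n → ℝ) : ℝ :=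
  ∫ ξ in S, (gradSq u ξ + F ξ (u ξ))

/-- `u` is a local minimizer of `ℱ` in `Ω`: it is locally Lipschitz, `ℱ_Ω(u)` is
well defined and finite, and `ℱ_Ω(u + φ) ≥ ℱ_Ω(u)` for all `φ ∈ C₀^∞(Ω̄)`. -/
def IsLocalMinimizer (F : Heis n → ℝ → ℝ) (Ω : Set (Heis n)) (u : Heis n → ℝ) : Prop :=
  LocallyLipschitz u ∧
  IntegrableOn (fun ξ => gradSq u ξ + F ξ (u ξ)) Ω ∧
  ∀ φ : Heis n → ℝ, ContDiff ℝ (⊤ : ℕ∞) φ → HasCompactSupport φ →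
    tsupport φ ⊆ closure Ω → energy F Ω u ≤ energy F Ω (u + φ)

end Heis

/-- Vectors `ω ∈ ℝ^{2n}`, split into the `x`-part and the `y`-part. -/
abbrev WVec (n : ℕ) : Type := (Fin n → ℝ) × (Fin n → ℝ)

/-- Integer vectors `k ∈ ℤ^{2n}`, split into the `x`-part and the `y`-part. -/
abbrev ZVec (n : ℕ) : Type := (Fin n → ℤ) × (Fin n → ℤ)

/-- The real vector associated to `k ∈ ℤ^{2n}`. -/
def realVec {n : ℕ} (k : ZVec n) : WVec n :=
  (fun i => (k.1 i : ℝ), fun i => (k.2 i : ℝ))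

/-- The point `(k, 0) ∈ ℍⁿ` associated to `k ∈ ℤ^{2n}`. -/
def intPt {n : ℕ} (k : ZVec n) : Heis n :=
  (fun i => (k.1 i : ℝ), fun i => (k.2 i : ℝ), 0)

/-- `ξ · (ω, 0) = z · ω` for `ξ = (z, t)`. -/
def dotW {n : ℕ} (ω : WVec n) (ξ : Heis n) : ℝ :=
  ∑ i, ω.1 i * ξ.1 i + ∑ i, ω.2 i * ξ.2.1 i

/-- The scalar product `ω · k` for `k ∈ ℤ^{2n}`. -/
def dotZ {n : ℕ} (ω : WVec n) (k : ZVec n) : ℝ :=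
  ∑ i, ω.1 i * (k.1 i : ℝ) + ∑ i, ω.2 i * (k.2 i : ℝ)

/-- The Euclidean norm `|ω|` of `ω ∈ ℝ^{2n}`. -/
noncomputable def normW {n : ℕ} (ω : WVec n) : ℝ :=
  Real.sqrt (∑ i, ω.1 i ^ 2 + ∑ i, ω.2 i ^ 2)

/-- `ω ∈ ℚ^{2n}`. -/
def IsRatVec {n : ℕ} (ω : WVec n) : Prop :=
  (∀ i, ∃ q : ℚ, ω.1 i = (q : ℝ)) ∧ (∀ i, ∃ q : ℚ, ω.2 i = (q : ℝ))

/-- The translation `T_k u(ξ) = u((k, 0) ∘ ξ)`. -/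
def transl {n : ℕ} (k : ZVec n) (u : Heis n → ℝ) : Heis n → ℝ :=
  fun ξ => u (Heis.mul (intPt k) ξ)

/-- `u` is `ω`-periodic: `u((k, 0) ∘ ξ) = u(ξ)` whenever `k ∈ ℤ^{2n}` and `ω · k = 0`. -/
def IsOmegaPeriodic {n : ℕ} (ω : WVec n) (u : Heis n → ℝ) : Prop :=
  ∀ k : ZVec n, dotZ ω k = 0 → ∀ ξ, u (Heis.mul (intPt k) ξ) = u ξ

/-- `u` is `2`-periodic in the vertical direction: `u(z, t + 2) = u(z, t)`. -/
def VertPeriodic {n : ℕ} (u : Heis n → ℝ) : Prop :=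
  ∀ ξ : Heis n, u (ξ.1, ξ.2.1, ξ.2.2 + 2) = u ξ

/-- The Birkhoff property with respect to `ω`: `u((k, 0) ∘ ξ) ≥ u(ξ)` whenever `ω · k ≥ 0`. -/
def Birkhoff {n : ℕ} (ω : WVec n) (u : Heis n → ℝ) : Prop :=
  ∀ k : ZVec n, 0 ≤ dotZ ω k → ∀ ξ, u ξ ≤ u (Heis.mul (intPt k) ξ)

/-- The constrained class `𝒴_M`: `ω`-periodic functions with `u ≥ 1 - δ` on
`{ξ · (ω,0) ≥ M|ω|}` and `u ≤ -1 + δ` on `{ξ · (ω,0) ≤ -M|ω|}`. -/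
def memY {n : ℕ} (δ M : ℝ) (ω : WVec n) (u : Heis n → ℝ) : Prop :=
  IsOmegaPeriodic ω u ∧
  (∀ ξ, M * normW ω ≤ dotW ω ξ → 1 - δ ≤ u ξ) ∧
  (∀ ξ, dotW ω ξ ≤ -(M * normW ω) → u ξ ≤ -1 + δ)

theorem dotW_intPt_mul {n : ℕ} (ω : WVec n) (k : ZVec n) (ξ : Heis n) :
    dotW ω (Heis.mul (intPt k) ξ) = dotZ ω k + dotW ω ξ := by
  simp only [dotW, dotZ, Heis.mul, intPt, Pi.add_apply, mul_add, Finset.sum_add_distrib]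
  ring

theorem VertPeriodic.add_two_mul_int {n : ℕ} {u : Heis n → ℝ} (hu : VertPeriodic u)
    (m : ℤ) (ξ : Heis n) : u (ξ.1, ξ.2.1, ξ.2.2 + 2 * (m : ℝ)) = u ξ := by
  have hper : Function.Periodic (fun t : ℝ => u (ξ.1, ξ.2.1, t)) 2 :=
    fun t => hu (ξ.1, ξ.2.1, t)
  simpa [mul_comm] using hper.int_mul m ξ.2.2

/-- Left translations by integer points commute up to an even integer vertical shift. -/
theorem exists_intPt_mul_comm {n : ℕ} (j k : ZVec n) (ξ : Heis n) :
    ∃ m : ℤ, Heis.mul (intPt k) (Heis.mul (intPt j) ξ) =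
      ((Heis.mul (intPt j) (Heis.mul (intPt k) ξ)).1,
        (Heis.mul (intPt j) (Heis.mul (intPt k) ξ)).2.1,
        (Heis.mul (intPt j) (Heis.mul (intPt k) ξ)).2.2 + 2 * (m : ℝ)) := by
  refine ⟨2 * ∑ i, (k.1 i * j.2 i - k.2 i * j.1 i), ?_⟩
  refine Prod.ext ?_ (Prod.ext ?_ ?_)
  · exact add_left_comm _ _ _
  · exact add_left_comm _ _ _
  · simp only [Heis.mul, intPt, Pi.add_apply]
    push_cast
    simp only [mul_add, Finset.sum_add_distrib, Finset.sum_sub_distrib]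
    simp only [mul_comm]
    ring

/-- Translates of a vertically `2`-periodic `ω`-periodic function are `ω`-periodic. -/
theorem IsOmegaPeriodic.transl {n : ℕ} {ω : WVec n} {u : Heis n → ℝ}
    (hu : IsOmegaPeriodic ω u) (hvert : VertPeriodic u) (k : ZVec n) :
    IsOmegaPeriodic ω (transl k u) := by
  intro j hj ξ
  obtain ⟨m, hm⟩ := exists_intPt_mul_comm j k ξ
  change u (Heis.mul (intPt k) (Heis.mul (intPt j) ξ)) = u (Heis.mul (intPt k) ξ)
  rw [hm, hvert.add_two_mul_int, hu j hj]

/-- **Lemma (min/max with translates stay in `𝒴_M`).** Fix `δ ∈ (0,1/2)`, `M ≥ 1` and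
`ω ∈ ℝ^{2n} ∖ {0}`, and let `u ∈ 𝒴_M` be `2`-periodic in the vertical direction.
Then `min {u, T_k u} ∈ 𝒴_M` whenever `ω · k ≥ 0`, and `max {u, T_k u} ∈ 𝒴_M` whenever
`ω · k ≤ 0`, where `T_k u(ξ) = u((k,0) ∘ ξ)`. -/
theorem minmax_transl_in_Y (n : ℕ) (hn : 1 ≤ n)
    (δ : ℝ) (hδ0 : 0 < δ) (hδ : δ < 1 / 2) (M : ℝ) (hM : 1 ≤ M)
    (ω : WVec n) (hω : ω ≠ 0)
    (u : Heis n → ℝ) (hu : memY δ M ω u) (hvert : VertPeriodic u) :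
    (∀ k : ZVec n, 0 ≤ dotZ ω k →
      memY δ M ω (fun ξ => min (u ξ) (transl k u ξ))) ∧
    (∀ k : ZVec n, dotZ ω k ≤ 0 →
      memY δ M ω (fun ξ => max (u ξ) (transl k u ξ))) := by
  obtain ⟨hper, hlow, hupp⟩ := hu
  refine ⟨fun k hk => ⟨fun j hj ξ => ?_, fun ξ hξ => ?_, fun ξ hξ => ?_⟩,
    fun k hk => ⟨fun j hj ξ => ?_, fun ξ hξ => ?_, fun ξ hξ => ?_⟩⟩
  · exact congrArg₂ min (hper j hj ξ) (hper.transl hvert k j hj ξ)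
  · exact le_min (hlow ξ hξ) (hlow _ (by rw [dotW_intPt_mul]; linarith))
  · exact (min_le_left _ _).trans (hupp ξ hξ)
  · exact congrArg₂ max (hper j hj ξ) (hper.transl hvert k j hj ξ)
  · exact (hlow ξ hξ).trans (le_max_left _ _)
  · exact max_le (hupp ξ hξ) (hupp _ (by rw [dotW_intPt_mul]; linarith))
end

section
/- Let ω∈ℚ^{2n}∖{0}, let k¹,…,k^{2n−1}∈ℤ^{2n}∖{0} be linearly independent vectors orthogonal to ω, let k^{2n}∈ℤ^{2n} be a nonzero multiple of ω, and let Θ>0. Define H_ω:={Σ_{j=1}^{2n−1} s_j k^j + α k^{2n} : s_j∈[−1/2,1/2), α∈ℝ}, ζ(z):=2 Σ_{j=1}^{2n} z_j z_{2n} Im((k^{2n})‾ k^j) for z=Σ_{j=1}^{2n} z_j k^j, and S_ω:={(z, t+ζ(z)) : z∈H_ω, t∈[−Θ,Θ)}. Let f:ℝ^{2n+1}→ℝ be an integrable function on S_ω satisfying f((k^j,0)∘ξ)=f(ξ) for j=1,…,2n−1 and all ξ, and f(z,t+2Θ)=f(z,t) for all (z,t). Then ∫_{T_v S_ω} f = ∫_{S_ω}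 f for every v∈ℝ^{2n}, where T_v S_ω:={(−v,0)∘ξ : ξ∈S_ω}. -/
open MeasureTheory Filter

/-- The standard symplectic form `Im(v̄ w)` on `ℝ^{2n} ≅ ℂⁿ`. -/
def symp {n : ℕ} (v w : WVec n) : ℝ :=
  ∑ i, (v.1 i * w.2 i - v.2 i * w.1 i)

/-- The point `z = Σ_{j<2n} s_j k^j + α k^{2n} ∈ ℝ^{2n}`. -/
noncomputable def zparam {n : ℕ} (kk : Fin (2 * n - 1) → ZVec n) (klast : ZVec n)
    (s : Fin (2 * n - 1) → ℝ) (α : ℝ) : WVec n :=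
  (∑ j, s j • realVec (kk j)) + α • realVec klast

/-- The fundamental region
`S_ω = {(z, t + ζ(z)) : z ∈ H_ω, t ∈ [-Θ, Θ)}`, where `H_ω` is parametrized by
`z = Σ_j s_j k^j + α k^{2n}` with `s_j ∈ [-1/2, 1/2)`, `α ∈ ℝ`, and
`ζ(z) = 2 Σ_{j=1}^{2n} z_j z_{2n} Im((k^{2n})‾ k^j)`. -/
noncomputable def fundRegion {n : ℕ} (kk : Fin (2 * n - 1) → ZVec n)
    (klast : ZVec n) (Θ : ℝ) : Set (Heis n) :=
  {ξ | ∃ (s : Fin (2 * n - 1) → ℝ) (α t : ℝ),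
    (∀ j, -(1:ℝ) / 2 ≤ s j ∧ s j < 1 / 2) ∧ (-Θ ≤ t ∧ t < Θ) ∧
    ξ = ((zparam kk klast s α).1, (zparam kk klast s α).2,
      t + 2 * ((∑ j, s j * α * symp (realVec klast) (realVec (kk j))) +
        α * α * symp (realVec klast) (realVec klast)))}

/-- `T_v S = {(-v, 0) ∘ ξ : ξ ∈ S}` for `v ∈ ℝ^{2n}`. -/
def translSet {n : ℕ} (v : WVec n) (S : Set (Heis n)) : Set (Heis n) :=
  (fun ξ => Heis.mul (-v.1, -v.2, 0) ξ) '' S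

theorem isAddHaarMeasure_volume_prod_prod (ι : Type*) [Fintype ι] :
    (volume : Measure (((ι → ℝ) × ℝ) × ℝ)).IsAddHaarMeasure :=
  have : (volume : Measure ((ι → ℝ) × ℝ)).IsAddHaarMeasure :=
    Measure.prod.instIsAddHaarMeasure volume volume
  Measure.prod.instIsAddHaarMeasure volume volume

theorem Heis.isAddHaarMeasure_volume (n : ℕ) : (volume : Measure (Heis n)).IsAddHaarMeasure :=
  have : (volume : Measure ((Fin n → ℝ) × ℝ)).IsAddHaarMeasure :=
    Measure.prod.instIsAddHaarMeasure volume volume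
  Measure.prod.instIsAddHaarMeasure volume volume

/-- The lattice `ℤ^ι × {0} × Tℤ` in `ℝ^ι × ℝ × ℝ`. -/
def stripLattice (ι : Type*) (T : ℝ) : AddSubgroup (((ι → ℝ) × ℝ) × ℝ) where
  carrier := {p | ∃ (m : ι → ℤ) (l : ℤ), p = ((fun j => (m j : ℝ), 0), l • T)}
  zero_mem' := ⟨0, 0, by ext <;> simp⟩
  add_mem' := by
    rintro _ _ ⟨m, l, rfl⟩ ⟨m', l', rfl⟩
    exact ⟨m + m', l + l', by ext <;> simp [add_mul]⟩
  neg_mem' := by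
    rintro _ ⟨m, l, rfl⟩
    exact ⟨-m, -l, by ext <;> simp⟩

instance countable_stripLattice (ι : Type*) [Finite ι] (T : ℝ) :
    Countable (stripLattice ι T) := by
  let φ : (ι → ℤ) × ℤ → stripLattice ι T := fun q =>
    ⟨((fun j => (q.1 j : ℝ), 0), q.2 • T), q.1, q.2, rfl⟩
  have hφ : Function.Surjective φ := by
    rintro ⟨_, m, l, rfl⟩
    exact ⟨(m, l), rfl⟩
  exact hφ.countable

/-- The unit strip in `ℝ^ι × ℝ × ℝ`, translated by `a` in the first variables and sheared by `η`
in the last one. -/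
def shearedStrip {ι : Type*} (Θ : ℝ) (a : ι → ℝ) (η : (ι → ℝ) × ℝ → ℝ) :
    Set (((ι → ℝ) × ℝ) × ℝ) :=
  {p | (∀ j, a j + p.1.1 j ∈ Set.Ico (-(1 : ℝ) / 2) (1 / 2)) ∧
    p.2 + η p.1 ∈ Set.Ico (-Θ) Θ}

theorem measurableSet_shearedStrip {ι : Type*} [Fintype ι] (Θ : ℝ) (a : ι → ℝ)
    {η : (ι → ℝ) × ℝ → ℝ} (hη : Measurable η) : MeasurableSet (shearedStrip Θ a η) := by
  have h1 : MeasurableSet {p : ((ι → ℝ) × ℝ) × ℝ |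
      ∀ j, a j + p.1.1 j ∈ Set.Ico (-(1 : ℝ) / 2) (1 / 2)} := by
    rw [Set.ofPred_forall]
    refine MeasurableSet.iInter fun j => ?_
    exact measurableSet_Ico.preimage (by fun_prop)
  have h2 : MeasurableSet {p : ((ι → ℝ) × ℝ) × ℝ | p.2 + η p.1 ∈ Set.Ico (-Θ) Θ} :=
    measurableSet_Ico.preimage (by fun_prop)
  exact h1.inter h2

theorem isAddFundamentalDomain_shearedStrip {ι : Type*} [Fintype ι] {Θ : ℝ} (hΘ : 0 < Θ)
    (a : ι → ℝ) {η : (ι → ℝ) × ℝ → ℝ} (hη : Measurable η)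
    (μ : Measure (((ι → ℝ) × ℝ) × ℝ)) :
    IsAddFundamentalDomain (stripLattice ι (2 * Θ)) (shearedStrip Θ a η) μ := by
  refine IsAddFundamentalDomain.mk' (measurableSet_shearedStrip Θ a hη).nullMeasurableSet ?_
  rintro ⟨⟨s, α⟩, t⟩
  have hm : ∀ j, ∃! m : ℤ, a j + s j + m • (1 : ℝ) ∈
      Set.Ico (-(1 : ℝ) / 2) (-(1 : ℝ) / 2 + 1) := fun j =>
    existsUnique_add_zsmul_mem_Ico one_pos _ _
  choose m hm hm' using hm
  obtain ⟨l, hl, hl'⟩ := existsUnique_add_zsmul_mem_Ico (show 0 < 2 * Θ by positivity)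
    (t + η ((fun j => (m j : ℝ)) + s, α)) (-Θ)
  refine ⟨⟨((fun j => (m j : ℝ), 0), l • (2 * Θ)), m, l, rfl⟩, ⟨fun j => ?_, ?_⟩, ?_⟩
  · have := hm j
    simp only [Set.mem_Ico, AddSubgroup.vadd_def, vadd_eq_add, Prod.mk_add_mk, Pi.add_apply,
      zsmul_eq_mul, mul_one] at this ⊢
    constructor <;> linarith
  · simp only [Set.mem_Ico, AddSubgroup.vadd_def, vadd_eq_add, Prod.mk_add_mk, zero_add] at hl ⊢
    constructor <;> linarith
  · rintro ⟨_, m', l', rfl⟩ ⟨h1, h2⟩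
    have hmm : m' = m := by
      funext j
      refine hm' j (m' j) ?_
      have := h1 j
      simp only [Set.mem_Ico, AddSubgroup.vadd_def, vadd_eq_add, Prod.mk_add_mk, Pi.add_apply,
        zsmul_eq_mul, mul_one] at this ⊢
      constructor <;> linarith
    subst hmm
    have hll : l' = l := by
      refine hl' l' ?_
      simp only [Set.mem_Ico, AddSubgroup.vadd_def, vadd_eq_add, Prod.mk_add_mk,
        zero_add] at h2 ⊢
      constructor <;> linarith
    subst hll
    rfl

theorem setIntegral_shearedStrip_eq_of_periodic {ι : Type*} [Fintype ι] {Θ : ℝ} (hΘ : 0 < Θ)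
    (a a' : ι → ℝ) {η η' : (ι → ℝ) × ℝ → ℝ} (hη : Measurable η) (hη' : Measurable η')
    {g : ((ι → ℝ) × ℝ) × ℝ → ℝ}
    (hg : ∀ (m : ι → ℤ) (s : ι → ℝ) (α t : ℝ),
      g (((fun j => (m j : ℝ)) + s, α), t) = g ((s, α), t))
    (hgt : ∀ (w : (ι → ℝ) × ℝ) (t : ℝ), g (w, t + 2 * Θ) = g (w, t)) :
    ∫ p in shearedStrip Θ a η, g p = ∫ p in shearedStrip Θ a' η', g p := by
  have := isAddHaarMeasure_volume_prod_prod ι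
  refine (isAddFundamentalDomain_shearedStrip hΘ a hη volume).setIntegral_eq
    (isAddFundamentalDomain_shearedStrip hΘ a' hη' volume) ?_
  rintro ⟨_, m, l, rfl⟩ ⟨⟨s, α⟩, t⟩
  have hp : Function.Periodic (fun t => g ((s, α), t)) (2 * Θ) := hgt (s, α)
  simp only [AddSubgroup.vadd_def, vadd_eq_add, Prod.mk_add_mk, zero_add]
  rw [hg, add_comm]
  exact hp.zsmul l t

theorem setIntegral_shearedStrip_eq_of_shear {ι : Type*} [Fintype ι] {Θ : ℝ} (hΘ : 0 < Θ)
    (a a' : ι → ℝ) {η η' e : (ι → ℝ) × ℝ → ℝ} (hη : Measurable η) (hη' : Measurable η')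
    (he : Measurable e) {g : ((ι → ℝ) × ℝ) × ℝ → ℝ}
    (hg : ∀ (m : ι → ℤ) (s : ι → ℝ) (α t : ℝ),
      g (((fun j => (m j : ℝ)) + s, α), t) = g ((s, α), t))
    (hgt : ∀ (w : (ι → ℝ) × ℝ) (t : ℝ), g (w, t + 2 * Θ) = g (w, t)) :
    ∫ p in shearedStrip Θ a η, g (p.1, p.2 - e p.1) =
      ∫ p in shearedStrip Θ a' η', g (p.1, p.2 - e p.1) := by
  let σ : (((ι → ℝ) × ℝ) × ℝ) ≃ᵐ (((ι → ℝ) × ℝ) × ℝ) :=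
    { toFun := fun p => (p.1, p.2 - e p.1)
      invFun := fun p => (p.1, p.2 + e p.1)
      left_inv := fun p => by simp
      right_inv := fun p => by simp
      measurable_toFun := measurable_fst.prodMk (measurable_snd.sub (he.comp measurable_fst))
      measurable_invFun := measurable_fst.prodMk (measurable_snd.add (he.comp measurable_fst)) }
  have hσ : MeasurePreserving σ volume volume := by
    refine MeasurePreserving.skew_product (g := fun w t => t - e w)
      (MeasurePreserving.id volume) (by fun_prop) (Eventually.of_forall fun w => ?_)
    exact (measurePreserving_sub_right volume (e w)).map_eq
  have key : ∀ (b : ι → ℝ) {θ : (ι → ℝ) × ℝ → ℝ}, ∫ p in shearedStrip Θ b θ, g (σ p) =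
      ∫ p in shearedStrip Θ b (θ + e), g p := by
    intro b θ
    have hpre : σ ⁻¹' shearedStrip Θ b (θ + e) = shearedStrip Θ b θ := by
      ext p
      have hp : p.2 - e p.1 + (θ + e) p.1 = p.2 + θ p.1 := by
        simp only [Pi.add_apply]
        ring
      change _ ∧ p.2 - e p.1 + (θ + e) p.1 ∈ _ ↔ _
      rw [hp]
      rfl
    rw [← hσ.setIntegral_preimage_emb σ.measurableEmbedding g, hpre]
  exact (key a).trans ((setIntegral_shearedStrip_eq_of_periodic hΘ a a' (hη.add he)
    (hη'.add he) hg hgt).trans (key a').symm)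

section Symplectic

variable {n : ℕ}

theorem symp_add_left (u v w : WVec n) : symp (u + v) w = symp u w + symp v w := by
  simp only [symp, Prod.fst_add, Prod.snd_add, Pi.add_apply, ← Finset.sum_add_distrib]
  exact Finset.sum_congr rfl fun i _ => by ring

theorem symp_add_right (u v w : WVec n) : symp u (v + w) = symp u v + symp u w := by
  simp only [symp, Prod.fst_add, Prod.snd_add, Pi.add_apply, ← Finset.sum_add_distrib]
  exact Finset.sum_congr rfl fun i _ => by ring

theorem symp_neg_left (u w : WVec n) : symp (-u) w = -symp u w := by
  simp only [symp, Prod.fst_neg, Prod.snd_neg, Pi.neg_apply, ← Finset.sum_neg_distrib]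
  exact Finset.sum_congr rfl fun i _ => by ring

theorem symp_neg_right (u w : WVec n) : symp u (-w) = -symp u w := by
  simp only [symp, Prod.fst_neg, Prod.snd_neg, Pi.neg_apply, ← Finset.sum_neg_distrib]
  exact Finset.sum_congr rfl fun i _ => by ring

theorem symp_self (u : WVec n) : symp u u = 0 :=
  Finset.sum_eq_zero fun i _ => by ring

theorem symp_zero_left (u : WVec n) : symp 0 u = 0 := by simp [symp]

theorem continuous_symp : Continuous fun p : WVec n × WVec n => symp p.1 p.2 := by
  unfold symp
  fun_prop

/-- The point `(z, t)` of `ℍⁿ`. -/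
def heisPt (z : WVec n) (t : ℝ) : Heis n := (z.1, z.2, t)

theorem mul_heisPt (z w : WVec n) (s t : ℝ) :
    Heis.mul (heisPt z s) (heisPt w t) = heisPt (z + w) (s + t + 2 * symp z w) := rfl

/-- The vectors `w` such that some left translation by `(w, c)` leaves `f` invariant. -/
def invariantTranslations (f : Heis n → ℝ) : AddSubgroup (WVec n) where
  carrier := {w | ∃ c, ∀ z t, f (heisPt (w + z) (c + t + 2 * symp w z)) = f (heisPt z t)}
  zero_mem' := ⟨0, fun z t => by simp [symp_zero_left]⟩
  add_mem' := by
    rintro u v ⟨c, hc⟩ ⟨d, hd⟩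
    refine ⟨c + d + 2 * symp u v, fun z t => ?_⟩
    rw [← hd z t, ← hc (v + z), symp_add_left, symp_add_right, add_assoc u]
    congr 2
    ring
  neg_mem' := by
    rintro u ⟨c, hc⟩
    refine ⟨-c, fun z t => ?_⟩
    rw [← hc, symp_add_right, symp_neg_left]
    congr 2
    · abel
    · rw [symp_neg_right, symp_self]
      ring

end Symplectic

section Coordinates

variable {n : ℕ} (kk : Fin (2 * n - 1) → ZVec n) (klast : ZVec n)

/-- The linear map `(s, α) ↦ Σ_j s_j k^j + α k^{2n}`. -/
noncomputable def zparamLinear : ((Fin (2 * n - 1) → ℝ) × ℝ) →ₗ[ℝ] WVec n :=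
  (Fintype.linearCombination ℝ fun j => realVec (kk j)).coprod
    (LinearMap.toSpanSingleton ℝ (WVec n) (realVec klast))

theorem zparamLinear_apply (s : Fin (2 * n - 1) → ℝ) (α : ℝ) :
    zparamLinear kk klast (s, α) = zparam kk klast s α := by
  simp [zparamLinear, zparam, Fintype.linearCombination_apply]

variable {kk klast}

theorem zparamLinear_injective {ω : WVec n} (hω0 : ω ≠ 0)
    (hind : LinearIndependent ℝ fun j => realVec (kk j))
    (horth : ∀ j, dotZ ω (kk j) = 0)
    (hlast : ∃ c : ℝ, c ≠ 0 ∧ realVec klast = c • ω) :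
    Function.Injective (zparamLinear kk klast) := by
  obtain ⟨c, hc, hkc⟩ := hlast
  rw [injective_iff_map_eq_zero]
  rintro ⟨s, α⟩ h
  rw [zparamLinear_apply, zparam, hkc] at h
  let D : WVec n →ₗ[ℝ] ℝ :=
    { toFun := fun z => ∑ i, ω.1 i * z.1 i + ∑ i, ω.2 i * z.2 i
      map_add' := fun x y => by
        simp only [Prod.fst_add, Prod.snd_add, Pi.add_apply, mul_add, Finset.sum_add_distrib]
        ring
      map_smul' := fun r x => by
        simp only [Prod.smul_fst, Prod.smul_snd, Pi.smul_apply, smul_eq_mul, mul_left_comm _ r,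
          ← Finset.mul_sum, mul_add, RingHom.id_apply] }
  have hDk : ∀ j, D (realVec (kk j)) = 0 := horth
  have hDω : D ω ≠ 0 := by
    intro h0
    have h0' : ∑ i, ω.1 i * ω.1 i + ∑ i, ω.2 i * ω.2 i = 0 := h0
    have p1 : 0 ≤ ∑ i, ω.1 i * ω.1 i := Finset.sum_nonneg fun i _ => mul_self_nonneg _
    have p2 : 0 ≤ ∑ i, ω.2 i * ω.2 i := Finset.sum_nonneg fun i _ => mul_self_nonneg _
    have q1 : ∑ i, ω.1 i * ω.1 i = 0 := by linarith
    have q2 : ∑ i, ω.2 i * ω.2 i = 0 := by linarith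
    rw [Finset.sum_eq_zero_iff_of_nonneg fun i _ => mul_self_nonneg _] at q1 q2
    refine hω0 (Prod.ext (funext fun i => ?_) (funext fun i => ?_))
    · simpa using q1 i (Finset.mem_univ i)
    · simpa using q2 i (Finset.mem_univ i)
  have hα : α = 0 := by
    have := congrArg D h
    simpa [hDk, hDω, hc] using this
  subst hα
  rw [zero_smul, add_zero] at h
  have hs : s = 0 := funext (Fintype.linearIndependent_iff.1 hind s h)
  rw [hs]
  rfl

end Coordinates

/-- Left translates of the fundamental region are sheared strips in the coordinates given by the
vectors `k^j`. -/
theorem preimage_translSet_fundRegion {n : ℕ} {kk : Fin (2 * n - 1) → ZVec n} {klast : ZVec n}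
    (e : ((Fin (2 * n - 1) → ℝ) × ℝ) ≃L[ℝ] WVec n)
    (he : ∀ s α, e (s, α) = zparam kk klast s α) (Θ : ℝ) (v : WVec n) :
    ∃ η : (Fin (2 * n - 1) → ℝ) × ℝ → ℝ, Measurable η ∧
      (fun p : ((Fin (2 * n - 1) → ℝ) × ℝ) × ℝ => heisPt (e p.1) p.2) ⁻¹'
        translSet v (fundRegion kk klast Θ) = shearedStrip Θ (e.symm v).1 η := by
  let ζ : (Fin (2 * n - 1) → ℝ) × ℝ → ℝ := fun w =>
    2 * ((∑ j, w.1 j * w.2 * symp (realVec klast) (realVec (kk j))) +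
      w.2 * w.2 * symp (realVec klast) (realVec klast))
  have hζ : Measurable ζ := by fun_prop
  refine ⟨fun w => 2 * symp v (e w) - ζ (e.symm v + w), ?_, ?_⟩
  · have h1 : Measurable fun w => symp v (e w) :=
      (continuous_symp.comp (continuous_const.prodMk e.continuous)).measurable
    fun_prop
  · ext ⟨w, t⟩
    constructor
    · rintro ⟨_, ⟨s, α, τ, hs, hτ, rfl⟩, h⟩
      have h' : heisPt (-v + e (s, α)) (0 + (τ + ζ (s, α)) + 2 * symp (-v) (e (s, α))) =
          heisPt (e w) t := by
        rw [he]
        exact h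
      have h1 : e w = -v + e (s, α) :=
        (Prod.ext (congrArg (·.1) h') (congrArg (·.2.1) h')).symm
      have h2 : t = 0 + (τ + ζ (s, α)) + 2 * symp (-v) (e (s, α)) :=
        (congrArg (·.2.2) h').symm
      have hw : e.symm v + w = (s, α) := by
        apply e.injective
        rw [map_add, e.apply_symm_apply, h1]
        abel
      refine ⟨fun j => ?_, ?_⟩
      · have : (e.symm v).1 j + w.1 j = s j := congrArg (fun q => q.1 j) hw
        simp only [this]
        exact hs j
      · have : t + (2 * symp v (e w) - ζ (e.symm v + w)) = τ := by
          rw [hw, h1, h2, symp_add_right, symp_neg_left, symp_neg_right, symp_self]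
          ring
        simp only [this]
        exact hτ
    · rintro ⟨h1, h2⟩
      refine ⟨heisPt (e (e.symm v + w)) (t + (2 * symp v (e w) - ζ (e.symm v + w)) +
        ζ (e.symm v + w)), ⟨(e.symm v + w).1, (e.symm v + w).2, _, h1, h2, ?_⟩, ?_⟩
      · rw [← he]
        rfl
      · change Heis.mul (heisPt (-v) 0) _ = heisPt (e w) t
        rw [mul_heisPt, map_add, e.apply_symm_apply, symp_add_right, symp_neg_left v,
          symp_neg_left v, symp_self]
        congr 1
        · abel
        · ring

/-- **Lemma (translation invariance of the integral over `S_ω`).** Let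
`ω ∈ ℚ^{2n} ∖ {0}`, let `k¹, …, k^{2n-1} ∈ ℤ^{2n} ∖ {0}` be linearly independent and
orthogonal to `ω`, let `k^{2n} ∈ ℤ^{2n}` be a nonzero multiple of `ω`, and let
`Θ > 0`. If `f` is integrable on `S_ω`, invariant under the Heisenberg translations by
`(k^j, 0)` for `j = 1, …, 2n-1`, and `2Θ`-periodic in the vertical variable, then
`∫_{T_v S_ω} f = ∫_{S_ω} f` for every `v ∈ ℝ^{2n}`. -/
theorem integral_translSet_fundRegion (n : ℕ) (hn : 1 ≤ n)
    (ω : WVec n) (hω0 : ω ≠ 0) (hωQ : IsRatVec ω)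
    (kk : Fin (2 * n - 1) → ZVec n) (klast : ZVec n)
    (hkk0 : ∀ j, kk j ≠ 0)
    (hind : LinearIndependent ℝ fun j => realVec (kk j))
    (horth : ∀ j, dotZ ω (kk j) = 0)
    (hlast : ∃ c : ℝ, c ≠ 0 ∧ realVec klast = c • ω)
    (Θ : ℝ) (hΘ : 0 < Θ)
    (f : Heis n → ℝ)
    (hper : ∀ j, ∀ ξ : Heis n, f (Heis.mul (intPt (kk j)) ξ) = f ξ)
    (hvert : ∀ ξ : Heis n, f (ξ.1, ξ.2.1, ξ.2.2 + 2 * Θ) = f ξ)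
    (hint : IntegrableOn f (fundRegion kk klast Θ)) :
    ∀ v : WVec n,
      ∫ ξ in translSet v (fundRegion kk klast Θ), f ξ =
        ∫ ξ in fundRegion kk klast Θ, f ξ := by
  have hrank : Module.finrank ℝ ((Fin (2 * n - 1) → ℝ) × ℝ) = Module.finrank ℝ (WVec n) := by
    simp only [Module.finrank_prod, Module.finrank_fin_fun, Module.finrank_self]
    omega
  let e : ((Fin (2 * n - 1) → ℝ) × ℝ) ≃L[ℝ] WVec n :=
    (LinearEquiv.ofInjectiveOfFinrankEq (zparamLinear kk klast)
      (zparamLinear_injective hω0 hind horth hlast) hrank).toContinuousLinearEquiv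
  have he : ∀ s α, e (s, α) = zparam kk klast s α := zparamLinear_apply kk klast
  let Ψ : (((Fin (2 * n - 1) → ℝ) × ℝ) × ℝ) ≃L[ℝ] Heis n :=
    (e.prodCongr (ContinuousLinearEquiv.refl ℝ ℝ)).trans
      (ContinuousLinearEquiv.prodAssoc ℝ (Fin n → ℝ) (Fin n → ℝ) ℝ)
  have hΨ : ∀ p, Ψ p = heisPt (e p.1) p.2 := fun p => rfl
  -- left translations by the lattice generated by the `k^j`
  have hinv : ∀ m : Fin (2 * n - 1) → ℤ, ∃ c, ∀ z t,
      f (heisPt (e (fun j => (m j : ℝ), 0) + z)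
        (c + t + 2 * symp (e (fun j => (m j : ℝ), 0)) z)) = f (heisPt z t) := by
    intro m
    have hk : ∀ j, realVec (kk j) ∈ invariantTranslations f := fun j =>
      ⟨0, fun z t => hper j (heisPt z t)⟩
    have hsum : e (fun j => (m j : ℝ), 0) ∈ invariantTranslations f := by
      rw [he, zparam, zero_smul, add_zero]
      refine sum_mem fun j _ => ?_
      rw [Int.cast_smul_eq_zsmul]
      exact zsmul_mem (hk j) _
    exact hsum
  choose c hc using hinv
  let fl : (Fin (2 * n - 1) → ℝ) × ℝ → Fin (2 * n - 1) → ℤ := fun w j => ⌊w.1 j⌋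
  let fr : (Fin (2 * n - 1) → ℝ) × ℝ → (Fin (2 * n - 1) → ℝ) × ℝ := fun w =>
    (fun j => Int.fract (w.1 j), w.2)
  have hfl : Measurable fl := by fun_prop
  have hfr : Measurable fr := by fun_prop
  let E : (Fin (2 * n - 1) → ℝ) × ℝ → ℝ := fun w =>
    c (fl w) + 2 * symp (e (fun j => (fl w j : ℝ), 0)) (e (fr w))
  have hE : Measurable E := by
    have h1 : Measurable fun w => c (fl w) := (measurable_of_countable c).comp hfl
    have h2 : Measurable fun w => (e (fun j => (fl w j : ℝ), 0), e (fr w)) := by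
      have h3 : Measurable fun m : Fin (2 * n - 1) → ℤ => e (fun j => (m j : ℝ), 0) :=
        measurable_of_countable _
      exact (h3.comp hfl).prodMk (e.continuous.measurable.comp hfr)
    exact h1.add ((continuous_symp.measurable.comp h2).const_mul 2)
  let g : ((Fin (2 * n - 1) → ℝ) × ℝ) × ℝ → ℝ := fun p => f (heisPt (e (fr p.1)) p.2)
  have hfg : ∀ p, f (Ψ p) = g (p.1, p.2 - E p.1) := by
    rintro ⟨w, t⟩
    have h := hc (fl w) (e (fr w)) (t - E w)
    have hw : (fun j => (fl w j : ℝ), (0 : ℝ)) + fr w = w := by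
      ext <;> simp [fl, fr]
    rw [← map_add, hw] at h
    change _ = f (heisPt (e (fr w)) (t - E w))
    rw [hΨ, ← h]
    congr 2
    simp only [E]
    ring
  have hgper : ∀ (m : Fin (2 * n - 1) → ℤ) (s : Fin (2 * n - 1) → ℝ) (α t : ℝ),
      g (((fun j => (m j : ℝ)) + s, α), t) = g ((s, α), t) := by
    intro m s α t
    simp [g, fr]
  have hgt : ∀ w t, g (w, t + 2 * Θ) = g (w, t) := fun w t => hvert (heisPt (e (fr w)) t)
  let μ : Measure (((Fin (2 * n - 1) → ℝ) × ℝ) × ℝ) := (volume : Measure (Heis n)).map Ψ.symm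
  have := Heis.isAddHaarMeasure_volume n
  have := isAddHaarMeasure_volume_prod_prod (Fin (2 * n - 1))
  have : μ.IsAddHaarMeasure := Ψ.symm.isAddHaarMeasure_map volume
  have hμ : μ = μ.addHaarScalarFactor volume • volume :=
    Measure.isAddLeftInvariant_eq_smul μ volume
  let M : (((Fin (2 * n - 1) → ℝ) × ℝ) × ℝ) ≃ᵐ Heis n := Ψ.toHomeomorph.toMeasurableEquiv
  have hΨμ : MeasurePreserving M μ volume :=
    MeasurePreserving.symm M.symm ⟨M.symm.measurable, rfl⟩
  have hconv : ∀ B : Set (Heis n), ∫ ξ in B, f ξ =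
      μ.addHaarScalarFactor volume • ∫ p in Ψ ⁻¹' B, f (Ψ p) := by
    intro B
    rw [← integral_smul_nnreal_measure, ← Measure.restrict_smul, ← hμ]
    exact (hΨμ.setIntegral_preimage_emb M.measurableEmbedding f B).symm
  have hzero : translSet 0 (fundRegion kk klast Θ) = fundRegion kk klast Θ := by
    have hid : (fun ξ : Heis n => Heis.mul (-(0 : WVec n).1, -(0 : WVec n).2, 0) ξ) = id := by
      funext ξ
      simp [Heis.mul]
    rw [translSet, hid, Set.image_id]
  intro v
  obtain ⟨η, hη, hv⟩ := preimage_translSet_fundRegion e he Θ v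
  obtain ⟨η₀, hη₀, h0⟩ := preimage_translSet_fundRegion e he Θ 0
  have hv' : Ψ ⁻¹' translSet v (fundRegion kk klast Θ) = _ := hv
  have h0' : Ψ ⁻¹' translSet 0 (fundRegion kk klast Θ) = _ := h0
  conv_rhs => rw [← hzero]
  rw [hconv, hconv, hv', h0']
  simp only [hfg]
  rw [setIntegral_shearedStrip_eq_of_shear hΘ _ _ hη hη₀ hE hgper hgt]
end

section
/- There exist positive constants r₀ and a₀, depending only on n, such that the following holds. Let ω∈ℝ^{2n}∖{0}, θ∈ℝ, r≥r₀ and a≥a₀. Suppose u:ℍⁿ→ℝ is 2-periodic in the vertical direction (u(z,t)=u(z,t+2)), satisfies the Birkhoff property with respect to ω, and 𝔅_r(ξ₀)⊆{ξ : u(ξ)<θ} for some ξ₀∈ℍⁿ. Then u(ξ)<θ for every ξ∈ℍⁿ with (ω,0)·(ξ−ξ₀) ≤ −a|ω|. -/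
open MeasureTheory Filter

/-- Vertical `2`-periodicity iterates to all even integer shifts. -/
theorem VertPeriodic.apply_add_two_mul {n : ℕ} {u : Heis n → ℝ} (hu : VertPeriodic u)
    (ξ : Heis n) (m : ℤ) : u (ξ.1, ξ.2.1, ξ.2.2 + 2 * m) = u ξ := by
  have hp : Function.Periodic (fun s : ℝ => u (ξ.1, ξ.2.1, s)) 2 :=
    fun s => hu (ξ.1, ξ.2.1, s)
  have h := hp.int_mul m ξ.2.2
  rwa [mul_comm (m : ℝ)] at h

theorem abs_fst_le_normW {n : ℕ} (ω : WVec n) (i : Fin n) : |ω.1 i| ≤ normW ω := by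
  refine Real.abs_le_sqrt ?_
  have h₁ := Finset.single_le_sum (f := fun j => ω.1 j ^ 2) (fun j _ => sq_nonneg _)
    (Finset.mem_univ i)
  have h₂ : 0 ≤ ∑ j, ω.2 j ^ 2 := Finset.sum_nonneg fun j _ => sq_nonneg _
  linarith

theorem abs_snd_le_normW {n : ℕ} (ω : WVec n) (i : Fin n) : |ω.2 i| ≤ normW ω := by
  refine Real.abs_le_sqrt ?_
  have h₁ := Finset.single_le_sum (f := fun j => ω.2 j ^ 2) (fun j _ => sq_nonneg _)
    (Finset.mem_univ i)
  have h₂ : 0 ≤ ∑ j, ω.1 j ^ 2 := Finset.sum_nonneg fun j _ => sq_nonneg _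
  linarith

/-- Rounding the coordinates of `w` changes a weighted sum with weights bounded by `c`
by at most `n * c / 2`. -/
theorem sum_mul_sub_le_sum_mul_round {n : ℕ} {v : Fin n → ℝ} {c : ℝ} (hv : ∀ i, |v i| ≤ c)
    (w : Fin n → ℝ) :
    ∑ i, v i * w i - n * (c / 2) ≤ ∑ i, v i * (round (w i) : ℝ) := by
  have h : ∑ i, v i * (w i - round (w i)) ≤ ∑ _i : Fin n, c / 2 := by
    refine Finset.sum_le_sum fun i _ => ?_
    calc v i * (w i - round (w i)) ≤ |v i| * |w i - round (w i)| := by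
          rw [← abs_mul]; exact le_abs_self _
      _ ≤ c * (1 / 2) := mul_le_mul (hv i) (abs_sub_round _) (abs_nonneg _)
          ((abs_nonneg _).trans (hv i))
      _ = c / 2 := by ring
  simp only [mul_sub, Finset.sum_sub_distrib, Finset.sum_const, Finset.card_univ,
    Fintype.card_fin, nsmul_eq_mul] at h
  linarith

theorem sum_sub_round_sq_le {n : ℕ} (w : Fin n → ℝ) :
    ∑ i, (w i - round (w i)) ^ 2 ≤ n / 4 := by
  have h : ∑ i, (w i - round (w i)) ^ 2 ≤ ∑ _i : Fin n, (1 / 4 : ℝ) := by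
    refine Finset.sum_le_sum fun i _ => ?_
    have := abs_le.1 (abs_sub_round (w i))
    nlinarith
  simp only [Finset.sum_const, Finset.card_univ, Fintype.card_fin, nsmul_eq_mul] at h
  linarith

theorem Heis.gauge_le {n : ℕ} {ξ : Heis n} {r : ℝ} (hr : 0 ≤ r)
    (h : (∑ k, ξ.1 k ^ 2 + ∑ k, ξ.2.1 k ^ 2) ^ 2 + ξ.2.2 ^ 2 ≤ r ^ 4) : gauge ξ ≤ r := by
  have h' := Real.rpow_le_rpow (by positivity) h (by norm_num : (0 : ℝ) ≤ 4⁻¹)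
  have hpow : (r ^ 4) ^ (4⁻¹ : ℝ) = r := by
    simpa using Real.pow_rpow_inv_natCast hr (n := 4) (by norm_num)
  rwa [hpow] at h'

/-- **Lemma (from a ball to a half space).** There exist `r₀, a₀ > 0`, depending only
on `n`, such that: if `u : ℍⁿ → ℝ` is `2`-periodic in the vertical direction,
satisfies the Birkhoff property with respect to `ω ∈ ℝ^{2n} ∖ {0}`, and
`𝔅_r(ξ₀) ⊆ {u < θ}` for some `r ≥ r₀`, then `u(ξ) < θ` for every `ξ` with
`(ω,0) · (ξ - ξ₀) ≤ -a|ω|`, for every `a ≥ a₀`. -/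
theorem birkhoff_halfspace (n : ℕ) (hn : 1 ≤ n) :
    ∃ r₀ > (0:ℝ), ∃ a₀ > (0:ℝ),
      ∀ ω : WVec n, ω ≠ 0 → ∀ θ : ℝ, ∀ r : ℝ, r₀ ≤ r → ∀ a : ℝ, a₀ ≤ a →
      ∀ u : Heis n → ℝ, VertPeriodic u → Birkhoff ω u →
      ∀ ξ₀ : Heis n, Heis.ball r ξ₀ ⊆ {ξ | u ξ < θ} →
      ∀ ξ : Heis n, dotW ω ξ - dotW ω ξ₀ ≤ -(a * normW ω) → u ξ < θ := by
  have hn' : (1 : ℝ) ≤ n := by exact_mod_cast hn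
  refine ⟨n + 2, by positivity, n, by positivity, ?_⟩
  intro ω _ θ r hr a ha u hper hB ξ₀ hball ξ hξ
  set k : ZVec n :=
    (fun i => round (ξ₀.1 i - ξ.1 i), fun i => round (ξ₀.2.1 i - ξ.2.1 i)) with hk
  have hdot : 0 ≤ dotZ ω k := by
    have h₁ := sum_mul_sub_le_sum_mul_round (abs_fst_le_normW ω) fun i => ξ₀.1 i - ξ.1 i
    have h₂ := sum_mul_sub_le_sum_mul_round (abs_snd_le_normW ω) fun i => ξ₀.2.1 i - ξ.2.1 i
    have h₃ : (n : ℝ) * normW ω ≤ a * normW ω :=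
      mul_le_mul_of_nonneg_right ha (Real.sqrt_nonneg _)
    simp only [mul_sub, Finset.sum_sub_distrib] at h₁ h₂
    simp only [dotW] at hξ
    simp only [dotZ, hk]
    linarith
  set η : Heis n := Heis.mul (intPt k) ξ with hη
  set T : ℝ := (Heis.mul (Heis.inv η) ξ₀).2.2 with hT
  set m : ℤ := ⌊T / 2⌋
  refine lt_of_le_of_lt (hB k hdot ξ) ?_
  rw [← hη, ← hper.apply_add_two_mul η m]
  refine hball (Heis.gauge_le (by linarith) ?_)
  have hx := sum_sub_round_sq_le fun i => ξ₀.1 i - ξ.1 i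
  have hy := sum_sub_round_sq_le fun i => ξ₀.2.1 i - ξ.2.1 i
  have ex : ∑ i, (Heis.mul (Heis.inv (η.1, η.2.1, η.2.2 + 2 * (m : ℝ))) ξ₀).1 i ^ 2 =
      ∑ i, (ξ₀.1 i - ξ.1 i - round (ξ₀.1 i - ξ.1 i)) ^ 2 := by
    refine Finset.sum_congr rfl fun i _ => ?_
    simp only [hη, hk, Heis.mul, Heis.inv, intPt, Pi.add_apply, Pi.neg_apply]
    ring
  have ey : ∑ i, (Heis.mul (Heis.inv (η.1, η.2.1, η.2.2 + 2 * (m : ℝ))) ξ₀).2.1 i ^ 2 =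
      ∑ i, (ξ₀.2.1 i - ξ.2.1 i - round (ξ₀.2.1 i - ξ.2.1 i)) ^ 2 := by
    refine Finset.sum_congr rfl fun i _ => ?_
    simp only [hη, hk, Heis.mul, Heis.inv, intPt, Pi.add_apply, Pi.neg_apply]
    ring
  have et : (Heis.mul (Heis.inv (η.1, η.2.1, η.2.2 + 2 * (m : ℝ))) ξ₀).2.2 = T - 2 * m := by
    simp only [hT, Heis.mul, Heis.inv]
    ring
  rw [ex, ey, et]
  have hm₁ : (m : ℝ) ≤ T / 2 := Int.floor_le _
  have hm₂ : T / 2 < m + 1 := Int.lt_floor_add_one _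
  set S := ∑ i, (ξ₀.1 i - ξ.1 i - round (ξ₀.1 i - ξ.1 i)) ^ 2 +
    ∑ i, (ξ₀.2.1 i - ξ.2.1 i - round (ξ₀.2.1 i - ξ.2.1 i)) ^ 2 with hS
  have hS₀ : 0 ≤ S := by positivity
  have hS₁ : S ≤ n := by linarith
  calc S ^ 2 + (T - 2 * m) ^ 2 ≤ (n : ℝ) ^ 2 + 2 ^ 2 := by
        gcongr
        · linarith
        · linarith
    _ ≤ ((n : ℝ) + 2) ^ 2 := by nlinarith
    _ ≤ ((n : ℝ) + 2) ^ 4 := pow_le_pow_right₀ (by linarith) (by norm_num)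
    _ ≤ r ^ 4 := by gcongr
end
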